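/- Let R = (E,φ) be a nonzero representation of a finite quiver Q on finite-dimensional complex inner product spaces whose inner products satisfy the (σ,τ)-vortex equations. Then R is (σ,τ)-polystable; moreover the decomposition can be chosen orthogonal: there exist pairwise orthogonal nonzero subrepresentations R¹,…,R^k with E_v = E¹_v ⊕ ⋯ ⊕ E^k_v for every v ∈ Q₀, each R^j being (σ,τ)-stable with μ_{σ,τ}(R^j) = μ_{σ,τ}(R) = 0. -/

import Mathlib

open scoped InnerProductSpace

noncomputable section

variable {Q0 Q1 : Type} [DecidableEq Q0] [Fintype Q0] [Fintype Q1]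
variable (t h : Q1 → Q0)
variable (E : Q0 → Type) [∀ v, NormedAddCommGroup (E v)]
  [∀ v, InnerProductSpace ℂ (E v)] [∀ v, FiniteDimensional ℂ (E v)]
variable (φ : ∀ a, E (t a) →ₗ[ℂ] E (h a))

/-- The moment-map/vortex operator at a vertex `v`:
`∑_{a ∈ h⁻¹(v)} φ_a ∘ φ_a* − ∑_{a ∈ t⁻¹(v)} φ_a* ∘ φ_a`. -/
def vortexOp (v : Q0) : E v →ₗ[ℂ] E v :=
  (∑ a : Q1, if hav : h a = v then hav ▸ (φ a ∘ₗ LinearMap.adjoint (φ a)) else 0)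
  - ∑ a : Q1, if hav : t a = v then hav ▸ (LinearMap.adjoint (φ a) ∘ₗ φ a) else 0

/-- The (σ,τ)-vortex equations over a point (the curvature terms vanish). -/
def SatisfiesVortex (τ : Q0 → ℝ) : Prop :=
  ∀ v, vortexOp t h E φ v = (τ v : ℂ) • LinearMap.id

/-- A family of subspaces is a subrepresentation if it is preserved by all the maps `φ_a`. -/
def IsSubrep (U : ∀ v, Submodule ℂ (E v)) : Prop :=
  ∀ a, ∀ x ∈ U (t a), φ a x ∈ U (h a)

/-- The (σ,τ)-degree of a family of subspaces: `−∑_v τ_v dim_ℂ U_v`. -/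
def degST (τ : Q0 → ℝ) (U : ∀ v, Submodule ℂ (E v)) : ℝ :=
  - ∑ v, τ v * (Module.finrank ℂ (U v) : ℝ)

/-- The (σ,τ)-slope of a family of subspaces. -/
def slopeST (σ τ : Q0 → ℝ) (U : ∀ v, Submodule ℂ (E v)) : ℝ :=
  degST E τ U / ∑ v, σ v * (Module.finrank ℂ (U v) : ℝ)

/-- (σ,τ)-stability: every nonzero proper subrepresentation has strictly smaller slope. -/
def IsStable (σ τ : Q0 → ℝ) : Prop :=
  ∀ U : ∀ v, Submodule ℂ (E v), IsSubrep t h E φ U →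
    (∃ v, U v ≠ ⊥) → (∃ v, U v ≠ ⊤) →
    slopeST E σ τ U < slopeST E σ τ (fun v => (⊤ : Submodule ℂ (E v)))

open LinearMap in
/-- If `f` maps `U` into `V`, then `tr (P_V f f*) - tr (P_U f* f)` is the squared Hilbert–Schmidt
norm of `P_V f - f P_U`. -/
theorem trace_starProjection_comp_sub {F G : Type*} [NormedAddCommGroup F] [InnerProductSpace ℂ F]
    [FiniteDimensional ℂ F] [NormedAddCommGroup G] [InnerProductSpace ℂ G]
    [FiniteDimensional ℂ G] (f : F →ₗ[ℂ] G) (U : Submodule ℂ F) (V : Submodule ℂ G)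
    (hf : ∀ x ∈ U, f x ∈ V) :
    trace ℂ G ((V.starProjection : G →ₗ[ℂ] G) ∘ₗ (f ∘ₗ adjoint f))
      - trace ℂ F ((U.starProjection : F →ₗ[ℂ] F) ∘ₗ (adjoint f ∘ₗ f)) =
    ((∑ i, ‖V.starProjection (f (stdOrthonormalBasis ℂ F i))
      - f (U.starProjection (stdOrthonormalBasis ℂ F i))‖ ^ 2 : ℝ) : ℂ) := by
  set P : F →ₗ[ℂ] F := (U.starProjection : F →ₗ[ℂ] F) with hP
  set R : G →ₗ[ℂ] G := (V.starProjection : G →ₗ[ℂ] G) with hR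
  have hPa : adjoint P = P := by
    rw [eq_comm, eq_adjoint_iff]
    exact Submodule.inner_starProjection_left_eq_right U
  have hRa : adjoint R = R := by
    rw [eq_comm, eq_adjoint_iff]
    exact Submodule.inner_starProjection_left_eq_right V
  have hPP : P ∘ₗ P = P := by
    ext x
    exact Submodule.starProjection_eq_self_iff.2 (U.starProjection_apply_mem x)
  have hRR : R ∘ₗ R = R := by
    ext x
    exact Submodule.starProjection_eq_self_iff.2 (V.starProjection_apply_mem x)
  have hfP : R ∘ₗ f ∘ₗ P = f ∘ₗ P := by
    ext x
    exact Submodule.starProjection_eq_self_iff.2 (hf _ (U.starProjection_apply_mem x))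
  have hnorm : trace ℂ F (adjoint (R ∘ₗ f - f ∘ₗ P) ∘ₗ (R ∘ₗ f - f ∘ₗ P)) =
      ((∑ i, ‖V.starProjection (f (stdOrthonormalBasis ℂ F i))
        - f (U.starProjection (stdOrthonormalBasis ℂ F i))‖ ^ 2 : ℝ) : ℂ) := by
    rw [trace_eq_sum_inner _ (stdOrthonormalBasis ℂ F)]
    push_cast
    refine Finset.sum_congr rfl fun i _ => ?_
    exact (adjoint_inner_right _ _ _).trans (inner_self_eq_norm_sq_to_K _)
  have h₁ : trace ℂ F ((adjoint f ∘ₗ R) ∘ₗ (R ∘ₗ f)) = trace ℂ G (R ∘ₗ (f ∘ₗ adjoint f)) := by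
    rw [LinearMap.comp_assoc, ← LinearMap.comp_assoc f R R, hRR, trace_comp_comm',
      LinearMap.comp_assoc]
  have h₂ : trace ℂ F ((adjoint f ∘ₗ R) ∘ₗ (f ∘ₗ P)) = trace ℂ F (P ∘ₗ (adjoint f ∘ₗ f)) := by
    rw [LinearMap.comp_assoc, hfP, ← LinearMap.comp_assoc, trace_comp_comm']
  have h₃ : trace ℂ F ((P ∘ₗ adjoint f) ∘ₗ (f ∘ₗ P)) = trace ℂ F (P ∘ₗ (adjoint f ∘ₗ f)) := by
    rw [← LinearMap.comp_assoc P, trace_comp_comm', LinearMap.comp_assoc, ← LinearMap.comp_assoc,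
      hPP]
  have h₄ : trace ℂ F ((P ∘ₗ adjoint f) ∘ₗ (R ∘ₗ f)) = trace ℂ F (P ∘ₗ (adjoint f ∘ₗ f)) := by
    have : trace ℂ F ((P ∘ₗ P) ∘ₗ (adjoint f ∘ₗ R ∘ₗ f)) =
        trace ℂ F (P ∘ₗ adjoint f ∘ₗ (R ∘ₗ f ∘ₗ P)) := by
      rw [LinearMap.comp_assoc, trace_comp_comm']
      rfl
    rw [hPP] at this
    rw [LinearMap.comp_assoc, this, hfP, ← LinearMap.comp_assoc, h₃]
  rw [← hnorm, map_sub, adjoint_comp, adjoint_comp, hPa, hRa, LinearMap.sub_comp,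
    LinearMap.comp_sub, LinearMap.comp_sub, map_sub, map_sub, map_sub, h₁, h₂, h₃, h₄]
  ring

/-- Summing over all vertices the traces of endomorphisms supported at the vertices `w a`. -/
theorem sum_trace_comp_sum_dite (P : ∀ v, E v →ₗ[ℂ] E v) (w : Q1 → Q0)
    (f : ∀ a, E (w a) →ₗ[ℂ] E (w a)) :
    ∑ v, LinearMap.trace ℂ (E v) (P v ∘ₗ ∑ a, if hw : w a = v then hw ▸ f a else 0) =
      ∑ a, LinearMap.trace ℂ (E (w a)) (P (w a) ∘ₗ f a) := by
  simp only [← Module.End.mul_eq_comp, Finset.mul_sum, map_sum]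
  rw [Finset.sum_comm]
  refine Finset.sum_congr rfl fun a _ => ?_
  rw [Finset.sum_eq_single (w a)]
  · simp
  · intro v _ hv
    simp [hv.symm]
  · simp

/-- For a subrepresentation of a solution of the vortex equations, minus the degree is a sum of
squared norms measuring the failure of the projections to commute with the maps `φ a`. -/
theorem neg_degST_eq_sum_sq {τ : Q0 → ℝ} (hvortex : SatisfiesVortex t h E φ τ)
    {U : ∀ v, Submodule ℂ (E v)} (hU : IsSubrep t h E φ U) :
    -degST E τ U = ∑ a, ∑ i, ‖(U (h a)).starProjection (φ a (stdOrthonormalBasis ℂ (E (t a)) i))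
      - φ a ((U (t a)).starProjection (stdOrthonormalBasis ℂ (E (t a)) i))‖ ^ 2 := by
  let P : ∀ v, E v →ₗ[ℂ] E v := fun v => ((U v).starProjection : E v →ₗ[ℂ] E v)
  have hP : ∀ v, LinearMap.trace ℂ (E v) (P v) = Module.finrank ℂ (U v) := fun v =>
    LinearMap.IsProj.trace ⟨(U v).starProjection_apply_mem,
      fun x hx => Submodule.starProjection_eq_self_iff.2 hx⟩
  have hτ : ∀ v, (τ v : ℂ) * Module.finrank ℂ (U v) =
      LinearMap.trace ℂ (E v) (P v ∘ₗ vortexOp t h E φ v) := fun v => by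
    rw [hvortex v, LinearMap.comp_smul, LinearMap.comp_id, map_smul, hP, smul_eq_mul]
  apply Complex.ofReal_injective
  calc ((-degST E τ U : ℝ) : ℂ) = ∑ v, (τ v : ℂ) * Module.finrank ℂ (U v) := by
        simp [degST]
    _ = ∑ v, LinearMap.trace ℂ (E v) (P v ∘ₗ vortexOp t h E φ v) :=
        Finset.sum_congr rfl fun v _ => hτ v
    _ = ∑ a, (LinearMap.trace ℂ _ (P (h a) ∘ₗ (φ a ∘ₗ LinearMap.adjoint (φ a)))
          - LinearMap.trace ℂ _ (P (t a) ∘ₗ (LinearMap.adjoint (φ a) ∘ₗ φ a))) := by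
        simp only [vortexOp, LinearMap.comp_sub, map_sub, Finset.sum_sub_distrib]
        congr 1
        · exact sum_trace_comp_sum_dite E P h _
        · exact sum_trace_comp_sum_dite E P t _
    _ = _ := by
        rw [Complex.ofReal_sum]
        exact Finset.sum_congr rfl fun a _ =>
          trace_starProjection_comp_sub (φ a) (U (t a)) (U (h a)) (hU a)

theorem degST_nonpos {τ : Q0 → ℝ} (hvortex : SatisfiesVortex t h E φ τ)
    {U : ∀ v, Submodule ℂ (E v)} (hU : IsSubrep t h E φ U) : degST E τ U ≤ 0 := by
  rw [← neg_nonneg, neg_degST_eq_sum_sq t h E φ hvortex hU]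
  positivity

/-- The orthogonal complement of a subrepresentation of degree zero is a subrepresentation. -/
theorem isSubrep_orthogonal {τ : Q0 → ℝ} (hvortex : SatisfiesVortex t h E φ τ)
    {U : ∀ v, Submodule ℂ (E v)} (hU : IsSubrep t h E φ U) (hdeg : degST E τ U = 0) :
    IsSubrep t h E φ fun v => (U v)ᗮ := by
  have hsum := neg_degST_eq_sum_sq t h E φ hvortex hU
  rw [hdeg, neg_zero, eq_comm, Finset.sum_eq_zero_iff_of_nonneg fun _ _ => by positivity] at hsum
  intro a x hx
  have hcomm : ((U (h a)).starProjection : E (h a) →ₗ[ℂ] E (h a)) ∘ₗ φ a =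
      φ a ∘ₗ ((U (t a)).starProjection : E (t a) →ₗ[ℂ] E (t a)) := by
    refine (stdOrthonormalBasis ℂ (E (t a))).toBasis.ext fun i => ?_
    have ha := hsum a (Finset.mem_univ a)
    rw [Finset.sum_eq_zero_iff_of_nonneg fun _ _ => by positivity] at ha
    simpa [sub_eq_zero] using ha i (Finset.mem_univ i)
  rw [← Submodule.starProjection_apply_eq_zero_iff] at hx ⊢
  have := LinearMap.congr_fun hcomm x
  simpa [hx] using this

theorem degST_add_degST_orthogonal_inf (τ : Q0 → ℝ) {U W : ∀ v, Submodule ℂ (E v)}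
    (hUW : ∀ v, U v ≤ W v) :
    degST E τ U + degST E τ (fun v => (U v)ᗮ ⊓ W v) = degST E τ W := by
  simp only [degST]
  rw [← neg_add, ← Finset.sum_add_distrib]
  congr 1
  refine Finset.sum_congr rfl fun v _ => ?_
  rw [← Submodule.finrank_add_inf_finrank_orthogonal (hUW v)]
  push_cast
  ring

theorem sum_mul_finrank_pos {σ : Q0 → ℝ} (hσ : ∀ v, 0 < σ v) {U : ∀ v, Submodule ℂ (E v)}
    (hU : ∃ v, U v ≠ ⊥) : 0 < ∑ v, σ v * (Module.finrank ℂ (U v) : ℝ) := by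
  obtain ⟨v, hv⟩ := hU
  refine Finset.sum_pos' (fun w _ => mul_nonneg (hσ w).le (Nat.cast_nonneg _))
    ⟨v, Finset.mem_univ v, mul_pos (hσ v) ?_⟩
  exact_mod_cast Nat.pos_of_ne_zero fun h0 => hv (Submodule.finrank_eq_zero.1 h0)

/-- A family that is a nonzero stable subrepresentation of degree zero. -/
def IsStableSummand (σ τ : Q0 → ℝ) (U : ∀ v, Submodule ℂ (E v)) : Prop :=
  ∃ hU : IsSubrep t h E φ U, (∃ v, U v ≠ ⊥) ∧ degST E τ U = 0 ∧
    IsStable t h (fun v => ↥(U v)) (fun a => (φ a).restrict (hU a)) σ τ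

/-- A nonzero subrepresentation of degree zero contains a stable one of degree zero. -/
theorem exists_isStableSummand_le {σ τ : Q0 → ℝ} (hσ : ∀ v, 0 < σ v)
    (hvortex : SatisfiesVortex t h E φ τ) {W : ∀ v, Submodule ℂ (E v)}
    (hW : IsSubrep t h E φ W) (hWnz : ∃ v, W v ≠ ⊥) (hWdeg : degST E τ W = 0) :
    ∃ U, IsStableSummand t h E φ σ τ U ∧ ∀ v, U v ≤ W v := by
  obtain ⟨U, ⟨hU, hUnz, hUdeg, hUW⟩, hmin⟩ := exists_minimalFor_of_wellFoundedLT
    (fun U : ∀ v, Submodule ℂ (E v) =>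
      IsSubrep t h E φ U ∧ (∃ v, U v ≠ ⊥) ∧ degST E τ U = 0 ∧ ∀ v, U v ≤ W v)
    (fun U => ∑ v, Module.finrank ℂ (U v)) ⟨W, hW, hWnz, hWdeg, fun _ => le_rfl⟩
  refine ⟨U, ⟨hU, hUnz, hUdeg, fun V hV hVnz hVprop => ?_⟩, hUW⟩
  let V' : ∀ v, Submodule ℂ (E v) := fun v => (V v).map (U v).subtype
  have hfin : ∀ v, Module.finrank ℂ (V' v) = Module.finrank ℂ (V v) := fun v =>
    Submodule.finrank_map_subtype_eq _ _
  have hV'U : ∀ v, V' v ≤ U v := fun v => Submodule.map_subtype_le _ _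
  have hV' : IsSubrep t h E φ V' := by
    rintro a _ ⟨x, hx, rfl⟩
    exact ⟨_, hV a x hx, rfl⟩
  have hV'nz : ∃ v, V' v ≠ ⊥ := hVnz.imp fun v hv h0 => hv <| by
    rw [← Submodule.finrank_eq_zero (R := ℂ), ← hfin, h0, finrank_bot]
  have hlt : ∑ v, Module.finrank ℂ (V' v) < ∑ v, Module.finrank ℂ (U v) := by
    obtain ⟨v, hv⟩ := hVprop
    refine Finset.sum_lt_sum (fun w _ => Submodule.finrank_mono (hV'U w))
      ⟨v, Finset.mem_univ v, ?_⟩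
    rw [hfin]
    exact Submodule.finrank_lt hv
  have hdeg : degST E τ V' < 0 := (degST_nonpos t h E φ hvortex hV').lt_of_ne fun h0 =>
    hlt.not_ge (hmin ⟨hV', hV'nz, h0, fun v => (hV'U v).trans (hUW v)⟩ hlt.le)
  have htop : slopeST (fun v => ↥(U v)) σ τ (fun v => ⊤) = 0 := by
    have : degST (fun v => ↥(U v)) τ (fun v => ⊤) = degST E τ U := by
      simp only [degST, finrank_top]
    rw [slopeST, this, hUdeg, zero_div]
  have hVdeg : degST (fun v => ↥(U v)) τ V = degST E τ V' := by
    simp only [degST, hfin]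
  rw [htop, slopeST, hVdeg]
  exact div_neg_of_neg_of_pos hdeg (sum_mul_finrank_pos (fun v => ↥(U v)) hσ hVnz)

/-- Every subrepresentation of degree zero is an orthogonal sum of stable ones. -/
theorem exists_orthogonal_decomposition {σ τ : Q0 → ℝ} (hσ : ∀ v, 0 < σ v)
    (hvortex : SatisfiesVortex t h E φ τ) (W : ∀ v, Submodule ℂ (E v))
    (hW : IsSubrep t h E φ W) (hWdeg : degST E τ W = 0) :
    ∃ (k : ℕ) (U : Fin k → ∀ v, Submodule ℂ (E v)),
      (∀ j, IsStableSummand t h E φ σ τ (U j)) ∧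
      (∀ i j, i ≠ j → ∀ v, U i v ≤ (U j v)ᗮ) ∧ ∀ v, ⨆ j, U j v = W v := by
  induction hn : ∑ v, Module.finrank ℂ (W v) using Nat.strong_induction_on generalizing W with
  | _ n ih =>
  by_cases hWnz : ∃ v, W v ≠ ⊥
  · obtain ⟨U, hUst, hUW⟩ := exists_isStableSummand_le t h E φ hσ hvortex hW hWnz hWdeg
    obtain ⟨hU, ⟨v₀, hv₀⟩, hUdeg, -⟩ := id hUst
    have hC := isSubrep_orthogonal t h E φ hvortex hU hUdeg
    have hadd := fun v => Submodule.finrank_add_inf_finrank_orthogonal (hUW v)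
    have hlt : ∑ v, Module.finrank ℂ ((U v)ᗮ ⊓ W v : Submodule ℂ (E v)) < n := by
      rw [← hn]
      refine Finset.sum_lt_sum (fun v _ => Submodule.finrank_mono inf_le_right)
        ⟨v₀, Finset.mem_univ v₀, ?_⟩
      have := hadd v₀
      have := Submodule.finrank_eq_zero.not.2 hv₀
      omega
    obtain ⟨k, V, hVst, hVorth, hVsup⟩ := ih _ hlt (fun v => (U v)ᗮ ⊓ W v)
      (fun a x hx => ⟨hC a x hx.1, hW a x hx.2⟩)
      (by rw [← hWdeg, ← degST_add_degST_orthogonal_inf E τ hUW, hUdeg, zero_add]) rfl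
    have hVU : ∀ j v, V j v ≤ (U v)ᗮ := fun j v =>
      (le_iSup (fun j => V j v) j).trans ((hVsup v).le.trans inf_le_left)
    refine ⟨k + 1, Fin.cons U V, Fin.cases hUst hVst, ?_, fun v => ?_⟩
    · intro i j hij v
      induction i using Fin.cases with
      | zero =>
        induction j using Fin.cases with
        | zero => exact absurd rfl hij
        | succ j =>
          simpa using (Submodule.le_orthogonal_orthogonal (U v)).trans
            (Submodule.orthogonal_le (hVU j v))
      | succ i =>
        induction j using Fin.cases with
        | zero => simpa using hVU i v
        | succ j => simpa using hVorth i j (fun h => hij (congrArg Fin.succ h)) v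
    · rw [← Submodule.sup_orthogonal_inf_of_hasOrthogonalProjection (hUW v), ← hVsup v]
      apply le_antisymm
      · refine iSup_le (Fin.cases le_sup_left fun j => ?_)
        exact (le_iSup (fun j => V j v) j).trans le_sup_right
      · refine sup_le ?_ (iSup_le fun j => ?_)
        · exact le_iSup (fun j => (Fin.cons U V : Fin (k + 1) → ∀ v, Submodule ℂ (E v)) j v) 0
        · exact le_iSup (fun j => (Fin.cons U V : Fin (k + 1) → ∀ v, Submodule ℂ (E v)) j v) j.succ
  · push Not at hWnz
    exact ⟨0, Fin.elim0, fun j => j.elim0, fun i => i.elim0, fun v => by simp [hWnz v]⟩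

/-- A nonzero representation of a finite quiver whose inner products satisfy
the (σ,τ)-vortex equations is (σ,τ)-polystable, with an orthogonal decomposition: there
are pairwise orthogonal nonzero subrepresentations `U 1, …, U k` with
`E_v = U 1 v ⊕ ⋯ ⊕ U k v` for every `v`, each being (σ,τ)-stable of slope
`μ_{σ,τ}(R) = 0`. -/
theorem statement4 (σ τ : Q0 → ℝ) (hσ : ∀ v, 0 < σ v)
    (hnz : ∃ v, Module.finrank ℂ (E v) ≠ 0)
    (hvortex : SatisfiesVortex t h E φ τ) :
    ∃ (k : ℕ) (U : Fin k → ∀ v, Submodule ℂ (E v))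
      (hsub : ∀ j, IsSubrep t h E φ (U j)),
      (∀ j, ∃ v, U j v ≠ ⊥) ∧
      (∀ i j, i ≠ j → ∀ v, U i v ≤ (U j v)ᗮ) ∧
      (∀ v, ⨆ j, U j v = ⊤) ∧
      (∀ j, IsStable t h (fun v => ↥(U j v))
        (fun a => (φ a).restrict (hsub j a)) σ τ) ∧
      (∀ j, slopeST E σ τ (U j) = slopeST E σ τ (fun v => (⊤ : Submodule ℂ (E v)))) ∧
      slopeST E σ τ (fun v => (⊤ : Submodule ℂ (E v))) = 0 := by
  have htop : IsSubrep t h E φ fun v => (⊤ : Submodule ℂ (E v)) := fun _ _ _ => trivial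
  have hdeg : degST E τ (fun v => (⊤ : Submodule ℂ (E v))) = 0 := by
    rw [← neg_eq_zero, neg_degST_eq_sum_sq t h E φ hvortex htop]
    refine Finset.sum_eq_zero fun a _ => Finset.sum_eq_zero fun i _ => ?_
    rw [Submodule.starProjection_eq_self_iff.2 Submodule.mem_top,
      Submodule.starProjection_eq_self_iff.2 Submodule.mem_top, sub_self, norm_zero, sq, zero_mul]
  have hslope : slopeST E σ τ (fun v => (⊤ : Submodule ℂ (E v))) = 0 := by
    rw [slopeST, hdeg, zero_div]
  obtain ⟨k, U, hst, horth, hsup⟩ :=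
    exists_orthogonal_decomposition t h E φ hσ hvortex _ htop hdeg
  choose hsub hne hUdeg hstable using hst
  refine ⟨k, U, hsub, hne, horth, hsup, hstable, fun j => ?_, hslope⟩
  rw [hslope, slopeST, hUdeg, zero_div]
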